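/- arXiv:1904.05001 — 2 statements merged into one kernel-verified Lean document; each statement's English description precedes it below -/
import Mathlib

section
/- (Corollary 2, 1-D cluster state.) Let G be the path graph on N ≥ 2 vertices with the 2-coloring into odd-labelled vertices V_1 and even-labelled vertices V_2, and let P_1 = ∏_{i ∈ V_1} (S_i + I)/2 and P_2 = ∏_{i ∈ V_2} (S_i + I)/2. Then every fully separable density matrix ρ — i.e., every ρ of the form ρ = Σ_i p_i |ψ_i⟩⟨ψ_i| with p_i ≥ 0, Σ_i p_i = 1, and each ψ_i a unit vector of the form ψ_i(x) = ∏_{v=1}^N φ_v^{(i)}(x(v)) — satisfies Tr(P_1 ρ) + Tr(P_2 ρ) ≤ 1 + 2^{−⌊N/2⌋}. -/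
open Matrix Finset
open scoped Classical ComplexOrder

noncomputable section

variable {V : Type} [Fintype V] [DecidableEq V]

/-- The indicator function δ_i : V → ZMod 2 of a vertex `i`. -/
def delta (i : V) : V → ZMod 2 := fun v => if v = i then 1 else 0

/-- The stabilizer `S_i = X_i ⊗_{j ∈ N(i)} Z_j` of the graph `G` at vertex `i`,
as a matrix acting on the N-qubit Hilbert space `(V → ZMod 2) → ℂ`:
`(S_i ψ)(x) = (-1)^{∑_{j ∈ N(i)} x(j)} ψ(x + δ_i)`. -/
def stab (G : SimpleGraph V) (i : V) : Matrix (V → ZMod 2) (V → ZMod 2) ℂ :=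
  Matrix.of fun x y =>
    if y = x + delta i then ((-1 : ℂ) ^ (∑ j ∈ univ.filter (fun j => G.Adj i j), (x j).val))
    else 0

/-- The number of edges `{i,j}` of `G` with `x i = x j = 1`. -/
def edgeCount (G : SimpleGraph V) (x : V → ZMod 2) : ℕ :=
  (G.edgeFinset.filter (fun e => ∀ v ∈ e, x v = 1)).card

/-- The graph state of `G`: `g(x) = 2^{-N/2} (-1)^{e(x)}`. -/
def graphState (G : SimpleGraph V) : (V → ZMod 2) → ℂ :=
  fun x => ((-1 : ℂ) ^ edgeCount G x) / ((Real.sqrt 2 ^ Fintype.card V : ℝ) : ℂ)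

/-- The stabilizer projector `∏_{i ∈ W} (S_i + I)/2` (the factors pairwise commute, so
the order of multiplication is irrelevant; we use the canonical enumeration of `W`). -/
def stabProj (G : SimpleGraph V) (W : Finset V) : Matrix (V → ZMod 2) (V → ZMod 2) ℂ :=
  (W.toList.map (fun i => (2:ℂ)⁻¹ • (stab G i + 1))).prod

/-- The off-diagonal adjacency block `Γ_{A,Ā}` over `ZMod 2`. -/
def gammaMat (G : SimpleGraph V) (A : Finset V) :
    Matrix {v // v ∈ A} {v // v ∉ A} (ZMod 2) :=
  Matrix.of fun i j => if G.Adj i.1 j.1 then 1 else 0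

/-- `r(A)`: the rank of `Γ_{A,Ā}` over `ZMod 2`. -/
def gRank (G : SimpleGraph V) (A : Finset V) : ℕ := (gammaMat G A).rank

/-- Restriction of a computational-basis label to a subset `A`. -/
def restrictTo (A : Finset V) (x : V → ZMod 2) : {v // v ∈ A} → ZMod 2 := fun v => x v.1

/-- Restriction of a computational-basis label to the complement of `A`. -/
def restrictOut (A : Finset V) (x : V → ZMod 2) : {v // v ∉ A} → ZMod 2 := fun v => x v.1

/-- `ψ` is a product vector across the bipartition `{A, V \ A}`. -/
def IsProdVec (A : Finset V) (ψ : (V → ZMod 2) → ℂ) : Prop :=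
  ∃ (φ : ({v // v ∈ A} → ZMod 2) → ℂ) (χ : ({v // v ∉ A} → ZMod 2) → ℂ),
    ∀ x, ψ x = φ (restrictTo A x) * χ (restrictOut A x)

/-- `P : Fin m → Finset V` is a partition of `V` into `m` nonempty disjoint subsets. -/
def IsPartition {m : ℕ} (P : Fin m → Finset V) : Prop :=
  (∀ t, (P t).Nonempty) ∧ (∀ t t', t ≠ t' → Disjoint (P t) (P t')) ∧
    univ.biUnion P = univ

/-- `ψ` is a unit vector: `⟨ψ, ψ⟩ = 1`. -/
def IsUnit' (ψ : (V → ZMod 2) → ℂ) : Prop := star ψ ⬝ᵥ ψ = 1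

/-- A pure state fully separable with respect to the partition `P`:
`ψ(x) = ∏_t φ_t(x|_{A_t})`. -/
def FullSepPure {m : ℕ} (P : Fin m → Finset V) (ψ : (V → ZMod 2) → ℂ) : Prop :=
  ∃ φ : (t : Fin m) → ({v // v ∈ P t} → ZMod 2) → ℂ,
    ∀ x, ψ x = ∏ t, φ t (restrictTo (P t) x)

/-- A `P`-fully separable density matrix. -/
def FullSep {m : ℕ} (P : Fin m → Finset V) (ρ : Matrix (V → ZMod 2) (V → ZMod 2) ℂ) : Prop :=
  ∃ (M : ℕ) (p : Fin M → ℝ) (ψ : Fin M → ((V → ZMod 2) → ℂ)),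
    (∀ i, 0 ≤ p i) ∧ (∑ i, p i) = 1 ∧ (∀ i, IsUnit' (ψ i)) ∧
    (∀ i, FullSepPure P (ψ i)) ∧
    ρ = ∑ i, (p i : ℂ) • vecMulVec (ψ i) (star (ψ i))

/-- A `P`-bi-separable density matrix: a convex mixture of unit vectors each of which is a
product vector across `{A, V \ A}` for some nonempty proper union of parts `A` of `P`. -/
def BiSep {m : ℕ} (P : Fin m → Finset V) (ρ : Matrix (V → ZMod 2) (V → ZMod 2) ℂ) : Prop :=
  ∃ (M : ℕ) (p : Fin M → ℝ) (ψ : Fin M → ((V → ZMod 2) → ℂ)),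
    (∀ i, 0 ≤ p i) ∧ (∑ i, p i) = 1 ∧ (∀ i, IsUnit' (ψ i)) ∧
    (∀ i, ∃ S : Finset (Fin m), S.Nonempty ∧ S ≠ univ ∧ IsProdVec (S.biUnion P) (ψ i)) ∧
    ρ = ∑ i, (p i : ℂ) • vecMulVec (ψ i) (star (ψ i))

/-- An `m`-separable density matrix: a convex mixture of unit vectors each of which is
fully separable with respect to some partition of `V` into `m` nonempty parts. -/
def MSep (m : ℕ) (ρ : Matrix (V → ZMod 2) (V → ZMod 2) ℂ) : Prop :=
  ∃ (M : ℕ) (p : Fin M → ℝ) (ψ : Fin M → ((V → ZMod 2) → ℂ)),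
    (∀ i, 0 ≤ p i) ∧ (∑ i, p i) = 1 ∧ (∀ i, IsUnit' (ψ i)) ∧
    (∀ i, ∃ P : Fin m → Finset V, IsPartition P ∧ FullSepPure P (ψ i)) ∧
    ρ = ∑ i, (p i : ℂ) • vecMulVec (ψ i) (star (ψ i))

/-- A proper `k`-coloring of `G` with color classes `C 0, …, C (k-1)`:
the classes are disjoint, cover `V`, and each is an independent set. -/
def IsColoring (G : SimpleGraph V) {k : ℕ} (C : Fin k → Finset V) : Prop :=
  (∀ l l', l ≠ l' → Disjoint (C l) (C l')) ∧ univ.biUnion C = univ ∧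
    ∀ l, ∀ i ∈ C l, ∀ j ∈ C l, ¬ G.Adj i j

/-- A density matrix: Hermitian positive semidefinite with trace 1. -/
def IsDensity (ρ : Matrix (V → ZMod 2) (V → ZMod 2) ℂ) : Prop :=
  ρ.PosSemidef ∧ ρ.trace = 1

/-- Glue `a : A → ZMod 2` and `b : Ā → ZMod 2` into a function on `V`. -/
def glue (A : Finset V) (a : {v // v ∈ A} → ZMod 2) (b : {v // v ∉ A} → ZMod 2) :
    V → ZMod 2 := fun v => if h : v ∈ A then a ⟨v, h⟩ else b ⟨v, h⟩

/-- The reduced density matrix `ρ_A` of a pure state `ψ`. -/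
def rdm (A : Finset V) (ψ : (V → ZMod 2) → ℂ) :
    Matrix ({v // v ∈ A} → ZMod 2) ({v // v ∈ A} → ZMod 2) ℂ :=
  Matrix.of fun a a' => ∑ b : {v // v ∉ A} → ZMod 2,
    ψ (glue A a b) * (starRingEnd ℂ) (ψ (glue A a' b))


/-- The star graph on `Fin N` (center `0`, i.e. vertex labelled 1). -/
def starGraph (N : ℕ) : SimpleGraph (Fin N) :=
  SimpleGraph.fromRel (fun i _ => (i : ℕ) = 0)

/-- The path graph on `Fin N` (vertex `v` represents the label `v+1`). -/
def pathGraph (N : ℕ) : SimpleGraph (Fin N) :=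
  SimpleGraph.fromRel (fun a b => (a : ℕ) + 1 = (b : ℕ))

/-- The `n × n` grid graph. -/
def gridGraph (n : ℕ) : SimpleGraph (Fin n × Fin n) :=
  SimpleGraph.fromRel (fun a b => Nat.dist (a.1 : ℕ) (b.1 : ℕ) + Nat.dist (a.2 : ℕ) (b.2 : ℕ) = 1)

/-- The number of edges of `G` crossing the bipartition `{A, V \ A}` (each such edge is
counted once, as the ordered pair whose first component lies in `A`). -/
def crossCount {W : Type} [Fintype W] [DecidableEq W] (G : SimpleGraph W) (A : Finset W) : ℕ :=
  ((univ ×ˢ univ).filter fun p : W × W => G.Adj p.1 p.2 ∧ p.1 ∈ A ∧ p.2 ∉ A).card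

theorem stab_mulVec (G : SimpleGraph V) (i : V) (ψ : (V → ZMod 2) → ℂ) (x : V → ZMod 2) :
    (stab G i *ᵥ ψ) x =
      (-1 : ℂ) ^ (∑ j ∈ univ.filter (fun j => G.Adj i j), (x j).val) * ψ (x + delta i) := by
  simp [Matrix.mulVec, dotProduct, stab, ite_mul]

theorem delta_add_delta {ι : Type} [DecidableEq ι] (i : ι) : delta i + delta i = 0 :=
  funext fun _ => CharTwo.add_self_eq_zero _

/-- The sign character of `ZMod 2`. -/
def signChar (t : ZMod 2) : ℂ := (-1) ^ t.val

theorem signChar_add (a b : ZMod 2) : signChar (a + b) = signChar a * signChar b := by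
  have key : (a + b).val % 2 = (a.val + b.val) % 2 := by
    revert a b; decide
  rw [signChar, signChar, signChar, ← pow_add, neg_one_pow_eq_pow_mod_two, key,
    ← neg_one_pow_eq_pow_mod_two]

theorem signChar_zero : signChar 0 = 1 := by simp [signChar]

theorem signChar_one : signChar 1 = -1 := by simp [signChar, ZMod.val_one]

theorem signChar_mul_self (a : ZMod 2) : signChar a * signChar a = 1 := by
  rw [← signChar_add, CharTwo.add_self_eq_zero, signChar_zero]

theorem star_signChar (a : ZMod 2) : star (signChar a) = signChar a := by
  simp [signChar]

theorem norm_signChar (a : ZMod 2) : ‖signChar a‖ = 1 := by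
  simp [signChar]

theorem neg_one_pow_sum_val {ι : Type*} (s : Finset ι) (x : ι → ZMod 2) :
    (-1 : ℂ) ^ (∑ j ∈ s, (x j).val) = signChar (∑ j ∈ s, x j) := by
  induction s using Finset.cons_induction with
  | empty => simp [signChar_zero]
  | cons a s ha ih =>
    rw [sum_cons, sum_cons, pow_add, ih, signChar_add]
    rfl

/-- The sum of `x` over the neighborhood of `i`. -/
def nbrSum (G : SimpleGraph V) (i : V) (x : V → ZMod 2) : ZMod 2 :=
  ∑ j ∈ univ.filter (fun j => G.Adj i j), x j

theorem nbrSum_add {ι : Type} [Fintype ι] (G : SimpleGraph ι) (i : ι) (x y : ι → ZMod 2) :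
    nbrSum G i (x + y) = nbrSum G i x + nbrSum G i y := by
  simp [nbrSum, sum_add_distrib]

theorem nbrSum_delta (G : SimpleGraph V) (i j : V) :
    nbrSum G i (delta j) = if G.Adj i j then 1 else 0 := by
  simp [nbrSum, delta]

theorem stab_mulVec_eq (G : SimpleGraph V) (i : V) (ψ : (V → ZMod 2) → ℂ) (x : V → ZMod 2) :
    (stab G i *ᵥ ψ) x = signChar (nbrSum G i x) * ψ (x + delta i) := by
  rw [stab_mulVec, neg_one_pow_sum_val, nbrSum]

theorem matrix_ext_of_mulVec {ι : Type*} [Fintype ι] {A B : Matrix ι ι ℂ}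
    (h : ∀ ψ x, (A *ᵥ ψ) x = (B *ᵥ ψ) x) : A = B :=
  Matrix.mulVec_injective (funext fun ψ => funext fun x => h ψ x)

theorem stab_mul_self (G : SimpleGraph V) (i : V) : stab G i * stab G i = 1 := by
  refine matrix_ext_of_mulVec fun ψ x => ?_
  rw [← Matrix.mulVec_mulVec, stab_mulVec_eq, stab_mulVec_eq, nbrSum_add, nbrSum_delta,
    add_assoc, delta_add_delta, Matrix.one_mulVec, if_neg (G.loopless.irrefl i), add_zero, add_zero,
    ← mul_assoc, signChar_mul_self, one_mul]

theorem stab_commute (G : SimpleGraph V) (i j : V) : Commute (stab G i) (stab G j) := by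
  refine matrix_ext_of_mulVec fun ψ x => ?_
  rw [← Matrix.mulVec_mulVec, ← Matrix.mulVec_mulVec]
  simp only [stab_mulVec_eq, nbrSum_add, nbrSum_delta, signChar_add, G.adj_comm j i,
    add_right_comm x (delta j) (delta i)]
  ring

theorem stab_isHermitian (G : SimpleGraph V) (i : V) : (stab G i).IsHermitian := by
  ext x y
  have hxy : x = y + delta i ↔ y = x + delta i := by
    constructor <;> rintro rfl <;> rw [add_assoc, delta_add_delta, add_zero]
  simp only [stab, Matrix.conjTranspose_apply, Matrix.of_apply, hxy, neg_one_pow_sum_val]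
  split_ifs with h
  · change star (signChar (nbrSum G i y)) = signChar (nbrSum G i x)
    rw [star_signChar, h, nbrSum_add, nbrSum_delta, if_neg (G.loopless.irrefl i), add_zero]
  · simp

/-- The projector `(S_i + I)/2`. -/
def stabHalf (G : SimpleGraph V) (i : V) : Matrix (V → ZMod 2) (V → ZMod 2) ℂ :=
  (2 : ℂ)⁻¹ • (stab G i + 1)

theorem stabHalf_commute (G : SimpleGraph V) (i j : V) :
    Commute (stabHalf G i) (stabHalf G j) := by
  refine Commute.smul_left (Commute.smul_right ?_ _) _
  exact ((stab_commute G i j).add_right (Commute.one_right _)).add_left (Commute.one_left _)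

theorem stab_mul_stabHalf (G : SimpleGraph V) (i : V) :
    stab G i * stabHalf G i = stabHalf G i := by
  rw [stabHalf, mul_smul_comm, mul_add, stab_mul_self, mul_one, add_comm]

theorem stabHalf_isStarProjection (G : SimpleGraph V) (i : V) :
    IsStarProjection (stabHalf G i) := by
  constructor
  · change stabHalf G i * stabHalf G i = stabHalf G i
    nth_rewrite 1 [stabHalf]
    rw [smul_mul_assoc, add_mul, stab_mul_stabHalf, one_mul, ← two_smul ℂ, smul_smul]
    norm_num
  · change star (stabHalf G i) = stabHalf G i
    rw [stabHalf, Matrix.star_eq_conjTranspose, Matrix.conjTranspose_smul,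
      Matrix.conjTranspose_add, (stab_isHermitian G i).eq, Matrix.conjTranspose_one]
    simp

theorem stabHalf_commute_prod (G : SimpleGraph V) (i : V) (l : List V) :
    Commute (stabHalf G i) (l.map (stabHalf G)).prod :=
  Commute.list_prod_right _ _ fun y hy => by
    obtain ⟨j, -, rfl⟩ := List.mem_map.1 hy
    exact stabHalf_commute G i j

theorem stabProj_eq (G : SimpleGraph V) (W : Finset V) :
    stabProj G W = (W.toList.map (stabHalf G)).prod := rfl

theorem stabHalf_commute_stabProj (G : SimpleGraph V) (i : V) (W : Finset V) :
    Commute (stabHalf G i) (stabProj G W) :=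
  stabHalf_commute_prod G i _

theorem stabProj_commute (G : SimpleGraph V) (W W' : Finset V) :
    Commute (stabProj G W) (stabProj G W') :=
  Commute.list_prod_left _ _ fun y hy => by
    obtain ⟨j, -, rfl⟩ := List.mem_map.1 hy
    exact stabHalf_commute_stabProj G j W'

theorem stabProj_isStarProjection (G : SimpleGraph V) (W : Finset V) :
    IsStarProjection (stabProj G W) := by
  rw [stabProj_eq]
  induction W.toList with
  | nil => simp
  | cons i l ih =>
    rw [List.map_cons, List.prod_cons]
    exact (stabHalf_isStarProjection G i).mul ih (stabHalf_commute_prod G i l)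

theorem stab_mul_stabProj (G : SimpleGraph V) {W : Finset V} {i : V} (hi : i ∈ W) :
    stab G i * stabProj G W = stabProj G W := by
  rw [stabProj_eq]
  have hi' : i ∈ W.toList := Finset.mem_toList.2 hi
  generalize W.toList = l at hi'
  induction l with
  | nil => simp at hi'
  | cons j l ih =>
    rw [List.map_cons, List.prod_cons]
    rcases List.mem_cons.1 hi' with rfl | h
    · rw [← mul_assoc, stab_mul_stabHalf]
    · rw [(stabHalf_commute_prod G j l).eq, ← mul_assoc, ih h]

theorem stab_mul_stabProj_mul (G : SimpleGraph V) {W W' : Finset V} {i : V}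
    (hi : i ∈ W ∨ i ∈ W') :
    stab G i * (stabProj G W * stabProj G W') = stabProj G W * stabProj G W' := by
  rcases hi with h | h
  · rw [← mul_assoc, stab_mul_stabProj G h]
  · rw [(stabProj_commute G W W').eq, ← mul_assoc, stab_mul_stabProj G h]

theorem dotProduct_isStarProjection {ι : Type*} [Fintype ι] {P : Matrix ι ι ℂ}
    (hP : IsStarProjection P) (ψ : ι → ℂ) :
    star ψ ⬝ᵥ (P *ᵥ ψ) = star (P *ᵥ ψ) ⬝ᵥ (P *ᵥ ψ) := by
  have hP' : Pᴴ = P := hP.isSelfAdjoint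
  rw [Matrix.star_mulVec, ← Matrix.dotProduct_mulVec, hP', Matrix.mulVec_mulVec,
    hP.isIdempotentElem.eq]

/-- Commuting projections satisfy `P + Q ≤ 1 + P Q` in every state. -/
theorem dotProduct_add_le_of_commute {ι : Type*} [Fintype ι] {P Q : Matrix ι ι ℂ}
    (hP : IsStarProjection P) (hQ : IsStarProjection Q) (hPQ : Commute P Q) (ψ : ι → ℂ) :
    star ψ ⬝ᵥ (P *ᵥ ψ) + star ψ ⬝ᵥ (Q *ᵥ ψ)
      ≤ star ψ ⬝ᵥ ψ + star ψ ⬝ᵥ ((P * Q) *ᵥ ψ) := by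
  have hc : Commute (1 - P) (1 - Q) :=
    ((Commute.one_left _).sub_left ((Commute.one_right _).sub_right hPQ))
  have h := dotProduct_isStarProjection (hP.one_sub.mul hQ.one_sub hc) ψ
  have h0 : 0 ≤ star ψ ⬝ᵥ (((1 - P) * (1 - Q)) *ᵥ ψ) := h ▸ dotProduct_star_self_nonneg _
  have e : (1 - P) * (1 - Q) = 1 - P - Q + P * Q := by noncomm_ring
  rw [e, Matrix.add_mulVec, Matrix.sub_mulVec, Matrix.sub_mulVec, Matrix.one_mulVec,
    dotProduct_add, dotProduct_sub, dotProduct_sub] at h0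
  rw [← sub_nonneg]
  convert h0 using 1
  ring

/-- A function invariant under all shifts by `delta i` is constant. -/
theorem eq_apply_zero_of_add_delta {f : (V → ZMod 2) → ℂ}
    (hf : ∀ i x, f (x + delta i) = f x) (x : V → ZMod 2) : f x = f 0 := by
  have key : ∀ (s : Finset V), f (∑ i ∈ s, x i • delta i) = f 0 := by
    intro s
    induction s using Finset.induction_on with
    | empty => simp
    | insert a s ha ih =>
      rw [sum_insert ha, add_comm]
      have h01 : ∀ t : ZMod 2, t = 0 ∨ t = 1 := by decide
      rcases h01 (x a) with h | h
      · rw [h, zero_smul, add_zero, ih]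
      · rw [h, one_smul, hf, ih]
  rw [← key univ]
  congr 1
  ext j
  simp [delta, Finset.sum_apply]

/-- The quadratic form counting the edges of the path inside the support of `x`. -/
def pathForm {n : ℕ} (x : Fin (n + 1) → ZMod 2) : ZMod 2 :=
  ∑ k : Fin n, x k.castSucc * x k.succ

theorem pathForm_cons {n : ℕ} (y : ZMod 2) (x : Fin (n + 1) → ZMod 2) :
    pathForm (Fin.cons y x : Fin (n + 2) → ZMod 2) = y * x 0 + pathForm x := by
  rw [pathForm, Fin.sum_univ_succ, pathForm]
  rfl

theorem nbrSum_pathGraph {n : ℕ} (i : Fin (n + 1)) (x : Fin (n + 1) → ZMod 2) :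
    nbrSum (pathGraph (n + 1)) i x =
      ∑ k : Fin n, (delta i k.castSucc * x k.succ + x k.castSucc * delta i k.succ) := by
  have h1 : nbrSum (pathGraph (n + 1)) i x =
      ∑ j : Fin (n + 1), (if (i : ℕ) + 1 = j then x j else 0)
        + ∑ j : Fin (n + 1), (if (j : ℕ) + 1 = i then x j else 0) := by
    rw [nbrSum, sum_filter, ← sum_add_distrib]
    refine sum_congr rfl fun j _ => ?_
    simp only [pathGraph, SimpleGraph.fromRel_adj, ne_eq, Fin.ext_iff]
    split_ifs <;> first | omega | simp
  rw [h1, Fin.sum_univ_succ, Fin.sum_univ_castSucc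
    (fun j : Fin (n + 1) => if (j : ℕ) + 1 = i then x j else 0), sum_add_distrib]
  have e1 : ¬ ((i : ℕ) + 1 = ((0 : Fin (n + 1)) : ℕ)) := by simp
  have e2 : ¬ (((Fin.last n : Fin (n + 1)) : ℕ) + 1 = i) := by
    have := i.isLt; simp; omega
  rw [if_neg e1, if_neg e2, zero_add, add_zero]
  congr 1 <;> refine sum_congr rfl fun k _ => ?_
  · simp [delta, Fin.ext_iff, eq_comm]
  · simp [delta, Fin.ext_iff]

theorem pathForm_add_delta {n : ℕ} (i : Fin (n + 1)) (x : Fin (n + 1) → ZMod 2) :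
    pathForm (x + delta i) = pathForm x + nbrSum (pathGraph (n + 1)) i x := by
  rw [nbrSum_pathGraph, pathForm, pathForm, ← sum_add_distrib]
  refine sum_congr rfl fun k _ => ?_
  have h : delta i k.castSucc * delta i k.succ = 0 := by
    simp only [delta, Fin.ext_iff, Fin.val_castSucc, Fin.val_succ]
    split_ifs <;> first | omega | simp
  simp only [Pi.add_apply]
  linear_combination h

/-- A vector stabilized by every `S_i` of the path is a multiple of the cluster state. -/
theorem eq_mul_signChar_pathForm {n : ℕ} {w : (Fin (n + 1) → ZMod 2) → ℂ}
    (hw : ∀ i, stab (pathGraph (n + 1)) i *ᵥ w = w) (x : Fin (n + 1) → ZMod 2) :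
    w x = w 0 * signChar (pathForm x) := by
  have key := eq_apply_zero_of_add_delta (f := fun x => w x * signChar (pathForm x))
    (fun i x => by
      have h := congrFun (hw i) x
      rw [stab_mulVec_eq] at h
      simp only [pathForm_add_delta, signChar_add]
      rw [← h]
      ring) x
  have h0 : pathForm (0 : Fin (n + 1) → ZMod 2) = 0 := by simp [pathForm]
  simp only [h0, signChar_zero, mul_one] at key
  rw [← key, mul_assoc, signChar_mul_self, mul_one]

/-- The overlap of a product vector with the unnormalized cluster state, as a function of the
label of the first qubit. -/
def pathAmp {n : ℕ} (φ : Fin (n + 1) → ZMod 2 → ℂ) (y : ZMod 2) : ℂ :=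
  ∑ x : Fin n → ZMod 2, (∏ v, φ v ((Fin.cons y x : Fin (n + 1) → ZMod 2) v)) *
    signChar (pathForm (Fin.cons y x : Fin (n + 1) → ZMod 2))

theorem sum_fin_cons {n : ℕ} (f : (Fin (n + 1) → ZMod 2) → ℂ) :
    ∑ x, f x = ∑ y : ZMod 2, ∑ x : Fin n → ZMod 2, f (Fin.cons y x) := by
  rw [← (Fin.consEquiv fun _ : Fin (n + 1) => ZMod 2).sum_comp, Fintype.sum_prod_type]
  rfl

theorem sum_pathAmp {n : ℕ} (φ : Fin (n + 1) → ZMod 2 → ℂ) :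
    ∑ x : Fin (n + 1) → ZMod 2, (∏ v, φ v (x v)) * signChar (pathForm x)
      = ∑ y, pathAmp φ y :=
  sum_fin_cons _

theorem pathAmp_zero (φ : Fin 1 → ZMod 2 → ℂ) (y : ZMod 2) : pathAmp φ y = φ 0 y := by
  simp [pathAmp, pathForm, signChar_zero]

theorem pathAmp_succ {n : ℕ} (φ : Fin (n + 2) → ZMod 2 → ℂ) (y : ZMod 2) :
    pathAmp φ y = φ 0 y * ∑ z, signChar (y * z) * pathAmp (fun v => φ v.succ) z := by
  rw [pathAmp, sum_fin_cons, mul_sum]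
  refine sum_congr rfl fun z _ => ?_
  rw [pathAmp, mul_sum, mul_sum]
  refine sum_congr rfl fun x _ => ?_
  rw [pathForm_cons, signChar_add, Fin.prod_univ_succ]
  simp only [Fin.cons_zero, Fin.cons_succ]
  ring

theorem sum_zmod_two {M : Type*} [AddCommMonoid M] (f : ZMod 2 → M) :
    ∑ y, f y = f 0 + f 1 :=
  Fin.sum_univ_two f

theorem pathAmp_bound {n : ℕ} (φ : Fin (n + 1) → ZMod 2 → ℂ) :
    (∑ y, ‖pathAmp φ y‖) ^ 2 ≤ 2 ^ ((n + 2) / 2) * ∏ v, ∑ y, ‖φ v y‖ ^ 2 ∧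
      ∑ y, ‖pathAmp φ y‖ ^ 2 ≤ 2 ^ ((n + 1) / 2) * ∏ v, ∑ y, ‖φ v y‖ ^ 2 := by
  induction n with
  | zero =>
    simp only [pathAmp_zero, sum_zmod_two, Fin.prod_univ_succ, Finset.univ_eq_empty,
      Finset.prod_empty]
    norm_num
    nlinarith [sq_nonneg (‖φ 0 0‖ - ‖φ 0 1‖)]
  | succ n ih =>
    obtain ⟨hA, hB⟩ := ih fun v => φ v.succ
    rw [Fin.prod_univ_succ]
    set R := ∏ v : Fin (n + 1), ∑ y, ‖φ v.succ y‖ ^ 2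
    set u := pathAmp fun v => φ v.succ
    have hu : ∀ y, ‖pathAmp φ y‖ = ‖φ 0 y‖ * ‖∑ z, signChar (y * z) * u z‖ := fun y => by
      rw [pathAmp_succ, norm_mul]
    set K := ∑ y, ‖φ 0 y‖ ^ 2
    have hK : 0 ≤ K := sum_nonneg fun _ _ => sq_nonneg _
    constructor
    · have hpar : ∑ y, ‖∑ z, signChar (y * z) * u z‖ ^ 2 = 2 * ∑ z, ‖u z‖ ^ 2 := by
        simp only [sum_zmod_two, zero_mul, mul_zero, one_mul, signChar_zero, signChar_one,
          neg_mul, ← sub_eq_add_neg]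
        have := parallelogram_law_with_norm ℂ (u 0) (u 1)
        linarith
      simp only [hu]
      calc _ ≤ K * ∑ y, ‖∑ z, signChar (y * z) * u z‖ ^ 2 := sum_mul_sq_le_sq_mul_sq _ _ _
        _ = K * (2 * ∑ z, ‖u z‖ ^ 2) := by rw [hpar]
        _ ≤ K * (2 * (2 ^ ((n + 1) / 2) * R)) := by gcongr
        _ = _ := by
          rw [show (n + 1 + 2) / 2 = (n + 1) / 2 + 1 by omega]; ring
    · have hsup : ∀ y, ‖∑ z, signChar (y * z) * u z‖ ≤ ∑ z, ‖u z‖ := fun y =>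
        (norm_sum_le _ _).trans_eq (by simp only [norm_mul, norm_signChar, one_mul])
      simp only [hu, mul_pow]
      calc _ ≤ ∑ y, ‖φ 0 y‖ ^ 2 * (∑ z, ‖u z‖) ^ 2 := by
            gcongr with y; exact hsup y
        _ = K * (∑ z, ‖u z‖) ^ 2 := by rw [sum_mul]
        _ ≤ K * (2 ^ ((n + 2) / 2) * R) := by gcongr
        _ = _ := by ring

theorem star_dotProduct_self_eq {ι : Type*} [Fintype ι] (ψ : ι → ℂ) :
    star ψ ⬝ᵥ ψ = ((∑ x, ‖ψ x‖ ^ 2 : ℝ) : ℂ) := by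
  simp [dotProduct, Complex.conj_mul']

/-- The squared overlap of a product unit vector with the cluster state is at most
`2 ^ (-⌊N/2⌋)`. -/
theorem norm_sq_sum_prod_le {n : ℕ} (φ : Fin (n + 1) → ZMod 2 → ℂ)
    (hφ : IsUnit' fun x : Fin (n + 1) → ZMod 2 => ∏ v, φ v (x v)) :
    ‖∑ x : Fin (n + 1) → ZMod 2, (∏ v, φ v (x v)) * signChar (pathForm x)‖ ^ 2
      ≤ 2 ^ ((n + 2) / 2) := by
  have hR : ∏ v, ∑ y, ‖φ v y‖ ^ 2 = 1 := by
    rw [IsUnit', star_dotProduct_self_eq] at hφ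
    rw [Fintype.prod_sum]
    simpa only [norm_prod, prod_pow] using
      Complex.ofReal_injective (hφ.trans Complex.ofReal_one.symm)
  have h := (pathAmp_bound φ).1
  rw [hR, mul_one] at h
  rw [sum_pathAmp]
  exact (pow_le_pow_left₀ (norm_nonneg _) (norm_sum_le _ _) 2).trans h

theorem dotProduct_stabilized_le {n : ℕ} {P : Matrix (Fin (n + 1) → ZMod 2) _ ℂ}
    (hP : IsStarProjection P) (hS : ∀ i, stab (pathGraph (n + 1)) i * P = P)
    (φ : Fin (n + 1) → ZMod 2 → ℂ) {ψ : (Fin (n + 1) → ZMod 2) → ℂ} (hψ : IsUnit' ψ)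
    (hφ : ∀ x, ψ x = ∏ v, φ v (x v)) :
    star ψ ⬝ᵥ (P *ᵥ ψ) ≤ ((((2 : ℝ) ^ ((n + 1) / 2))⁻¹ : ℝ) : ℂ) := by
  obtain rfl : ψ = fun x => ∏ v, φ v (x v) := funext hφ
  have hF := norm_sq_sum_prod_le φ hψ
  set ψ : (Fin (n + 1) → ZMod 2) → ℂ := fun x => ∏ v, φ v (x v)
  set F : ℂ := ∑ x : Fin (n + 1) → ZMod 2, (∏ v, φ v (x v)) * signChar (pathForm x)
  have hw := eq_mul_signChar_pathForm (w := P *ᵥ ψ) fun i => by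
    rw [Matrix.mulVec_mulVec, hS]
  set c := (P *ᵥ ψ) 0
  have h1 : star ψ ⬝ᵥ (P *ᵥ ψ) = c * star F := by
    simp only [dotProduct, F, star_sum, mul_sum]
    refine sum_congr rfl fun x _ => ?_
    rw [hw, star_mul', star_signChar, Pi.star_apply]
    ring
  have h2 : star ψ ⬝ᵥ (P *ᵥ ψ) = ((‖c‖ ^ 2 * 2 ^ (n + 1) : ℝ) : ℂ) := by
    rw [dotProduct_isStarProjection hP, star_dotProduct_self_eq]
    congr 1
    simp only [hw, norm_mul, norm_signChar, mul_one]
    simp [ZMod.card, mul_comm]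
  have h3 : ‖c‖ ^ 2 * 2 ^ (n + 1) = ‖c‖ * ‖F‖ := by
    have := congrArg norm (h2.symm.trans h1)
    rwa [Complex.norm_of_nonneg (by positivity), norm_mul, norm_star] at this
  rw [h2, Complex.real_le_real]
  have hsplit : (2 : ℝ) ^ (n + 1) = 2 ^ ((n + 2) / 2) * 2 ^ ((n + 1) / 2) := by
    rw [← pow_add]
    congr 1
    omega
  have hB : (0 : ℝ) < 2 ^ ((n + 1) / 2) := by positivity
  have hX : 0 ≤ ‖c‖ ^ 2 * 2 ^ (n + 1) := by positivity
  have h4 : (‖c‖ ^ 2 * 2 ^ (n + 1)) ^ 2 * 2 ^ ((n + 1) / 2) ≤ ‖c‖ ^ 2 * 2 ^ (n + 1) := by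
    calc _ = ‖c‖ ^ 2 * (‖F‖ ^ 2 * 2 ^ ((n + 1) / 2)) := by rw [h3]; ring
      _ ≤ ‖c‖ ^ 2 * (2 ^ ((n + 2) / 2) * 2 ^ ((n + 1) / 2)) := by gcongr
      _ = _ := by rw [hsplit]
  rw [← one_div, le_div_iff₀ hB]
  rcases hX.eq_or_lt with h0 | hpos
  · rw [← h0, zero_mul]
    exact zero_le_one
  · refine le_of_mul_le_mul_left ?_ hpos
    linarith

/-- Corollary 2 for the 1-D cluster state: with the 2-coloring of the path graph on
`N ≥ 2` vertices into odd-labelled vertices (even indices) and even-labelled vertices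
(odd indices), every fully separable density matrix `ρ` satisfies
`Tr(P_1 ρ) + Tr(P_2 ρ) ≤ 1 + 2^{-⌊N/2⌋}`. -/
theorem witness_fullSep_path (N : ℕ) (hN : 2 ≤ N)
    (ρ : Matrix (Fin N → ZMod 2) (Fin N → ZMod 2) ℂ) (hρd : IsDensity ρ)
    (hρ : ∃ (M : ℕ) (p : Fin M → ℝ) (ψ : Fin M → ((Fin N → ZMod 2) → ℂ)),
      (∀ i, 0 ≤ p i) ∧ (∑ i, p i) = 1 ∧ (∀ i, IsUnit' (ψ i)) ∧
      (∀ i, ∃ φ : Fin N → (ZMod 2 → ℂ), ∀ x, ψ i x = ∏ v, φ v (x v)) ∧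
      ρ = ∑ i, (p i : ℂ) • vecMulVec (ψ i) (star (ψ i))) :
    (stabProj (pathGraph N) (univ.filter fun v : Fin N => (v : ℕ) % 2 = 0) * ρ).trace
      + (stabProj (pathGraph N) (univ.filter fun v : Fin N => (v : ℕ) % 2 = 1) * ρ).trace
      ≤ ((1 + ((2 : ℝ) ^ (N / 2))⁻¹ : ℝ) : ℂ) := by
  obtain ⟨n, rfl⟩ : ∃ n, N = n + 1 := ⟨N - 1, by omega⟩
  obtain ⟨M, p, ψ, hp, hsum, hunit, hprod, rfl⟩ := hρ
  set A := univ.filter fun v : Fin (n + 1) => (v : ℕ) % 2 = 0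
  set B := univ.filter fun v : Fin (n + 1) => (v : ℕ) % 2 = 1
  set G := pathGraph (n + 1)
  have hAB : ∀ i, i ∈ A ∨ i ∈ B := fun i => by
    simpa [A, B] using Nat.mod_two_eq_zero_or_one i
  have htr : ∀ P : Matrix (Fin (n + 1) → ZMod 2) (Fin (n + 1) → ZMod 2) ℂ,
      (P * ∑ i, (p i : ℂ) • vecMulVec (ψ i) (star (ψ i))).trace
        = ∑ i, (p i : ℂ) * (star (ψ i) ⬝ᵥ (P *ᵥ ψ i)) := fun P => by
    rw [Finset.mul_sum, Matrix.trace_sum]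
    refine sum_congr rfl fun i _ => ?_
    rw [mul_smul_comm, Matrix.trace_smul, Matrix.mul_vecMulVec, Matrix.trace_vecMulVec,
      dotProduct_comm, smul_eq_mul]
  have hA := stabProj_isStarProjection G A
  have hB := stabProj_isStarProjection G B
  have hc := stabProj_commute G A B
  have hpure : ∀ i, star (ψ i) ⬝ᵥ (stabProj G A *ᵥ ψ i) + star (ψ i) ⬝ᵥ (stabProj G B *ᵥ ψ i)
      ≤ ((1 + ((2 : ℝ) ^ ((n + 1) / 2))⁻¹ : ℝ) : ℂ) := fun i => by
    obtain ⟨φ, hφ⟩ := hprod i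
    refine (dotProduct_add_le_of_commute hA hB hc (ψ i)).trans ?_
    rw [show star (ψ i) ⬝ᵥ ψ i = 1 from hunit i, Complex.ofReal_add, Complex.ofReal_one]
    gcongr
    exact dotProduct_stabilized_le (hA.mul hB hc)
      (fun i => stab_mul_stabProj_mul G (hAB i)) φ (hunit i) hφ
  rw [htr, htr, ← sum_add_distrib]
  calc _ = ∑ i, (p i : ℂ) * (star (ψ i) ⬝ᵥ (stabProj G A *ᵥ ψ i)
          + star (ψ i) ⬝ᵥ (stabProj G B *ᵥ ψ i)) := by simp only [mul_add]
    _ ≤ ∑ i, (p i : ℂ) * ((1 + ((2 : ℝ) ^ ((n + 1) / 2))⁻¹ : ℝ) : ℂ) :=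
        sum_le_sum fun i _ => mul_le_mul_of_nonneg_left (hpure i)
          (Complex.zero_le_real.2 (hp i))
    _ = _ := by rw [← sum_mul, ← Complex.ofReal_sum, hsum, Complex.ofReal_one, one_mul]
end
end

section
/- For the path graph on N vertices, the maximum of r(A) over all nonempty proper subsets A of {1, …, N} equals ⌊N/2⌋, and the maximum is attained by taking A to be the set of odd-labelled vertices. (This is the key optimization in Corollary 2 for the 1-D cluster state: the maximal bipartite entanglement entropy of the N-qubit 1-D cluster state is ⌊N/2⌋.) -/
open Matrix Finset
open scoped Classical ComplexOrder

noncomputable section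

variable {V : Type} [Fintype V] [DecidableEq V]

lemma gRank_le_half_card (G : SimpleGraph V) (A : Finset V) :
    gRank G A ≤ Fintype.card V / 2 := by
  have hrow : gRank G A ≤ Fintype.card {v // v ∈ A} := Matrix.rank_le_card_height _
  have hcol : gRank G A ≤ Fintype.card {v // v ∉ A} := Matrix.rank_le_card_width _
  have hsum := Fintype.card_subtype_compl (fun v => v ∈ A)
  have hle := Fintype.card_subtype_le (fun v => v ∈ A)
  omega

lemma gRank_pathGraph_even (N : ℕ) :
    gRank (pathGraph N) (univ.filter fun v : Fin N => (v : ℕ) % 2 = 0) = N / 2 := by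
  refine le_antisymm (by simpa using gRank_le_half_card (pathGraph N) _) ?_
  let A : Finset (Fin N) := univ.filter fun v => (v : ℕ) % 2 = 0
  let row : Fin (N / 2) → {v // v ∈ A} := fun i =>
    ⟨⟨2 * i, by omega⟩, by simp [A]⟩
  let col : Fin (N / 2) → {v // v ∉ A} := fun i =>
    ⟨⟨2 * i + 1, by omega⟩, by simp [A]⟩
  -- Rows `2 * i` and columns `2 * j + 1` give a lower triangular matrix with unit diagonal.
  let M := (gammaMat (pathGraph N) A).submatrix row col
  have htri : M.IsLowerTriangular := by
    intro i j hij
    have hij' : (i : ℕ) < j := hij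
    simp only [M, row, col, gammaMat, pathGraph, Matrix.submatrix_apply, Matrix.of_apply,
      SimpleGraph.fromRel_adj, ne_eq, Fin.mk.injEq]
    exact if_neg (by omega)
  have hdiag : ∀ i, M i i = 1 := by
    intro i
    simp [M, row, col, gammaMat, pathGraph]
  have hdet : M.det ≠ 0 := by
    rw [Matrix.det_of_isLowerTriangular M htri]
    simp [hdiag]
  calc N / 2 = M.rank := by rw [Matrix.rank_of_det_ne_zero hdet, Fintype.card_fin]
    _ ≤ gRank (pathGraph N) A := Matrix.rank_submatrix_le _ _ _

/-- For the path graph on `N` vertices, the maximum of `r(A)` over all nonempty proper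
subsets `A` equals `⌊N/2⌋`, and it is attained by the set of odd-labelled vertices
(even indices): the maximal bipartite entanglement entropy of the `N`-qubit 1-D cluster
state is `⌊N/2⌋`. -/
theorem pathGraph_max_gRank (N : ℕ) :
    sSup {r : ℕ | ∃ A : Finset (Fin N),
        A.Nonempty ∧ A ≠ univ ∧ gRank (pathGraph N) A = r} = N / 2
    ∧ gRank (pathGraph N) (univ.filter fun v : Fin N => (v : ℕ) % 2 = 0) = N / 2 := by
  refine ⟨?_, gRank_pathGraph_even N⟩
  have hbound : ∀ r ∈ {r : ℕ | ∃ A : Finset (Fin N),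
      A.Nonempty ∧ A ≠ univ ∧ gRank (pathGraph N) A = r}, r ≤ N / 2 := by
    rintro r ⟨A, -, -, rfl⟩
    simpa using gRank_le_half_card (pathGraph N) A
  refine le_antisymm (csSup_le' hbound) ?_
  rcases Nat.lt_or_ge N 2 with hN | hN
  · simp [Nat.div_eq_of_lt hN]
  · refine le_csSup ⟨N / 2, hbound⟩ ⟨_, ⟨⟨0, by omega⟩, by simp⟩, fun h => ?_,
      gRank_pathGraph_even N⟩
    have hmem := h ▸ mem_univ (⟨1, hN⟩ : Fin N)
    simp at hmem
end
end
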